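/- For every t > 0, t^4 · Q(t) = ∫_0^∞ h^{(4)}(s) e^{−ts} ds, where h^{(4)} is the fourth derivative of h on (0, ∞). -/

import Mathlib

open Real Set Filter Topology

/-- The trigamma function `ψ'(t) = ∑_{n=0}^∞ 1/(t+n)^2`. -/
noncomputable def trigamma (t : ℝ) : ℝ := ∑' n : ℕ, 1 / (t + n) ^ 2

/-- `Q(t) = ψ'(t) − 1/t − 1/(2t²) − 1/(6t³) + 1/(30t⁵)`. -/
noncomputable def Q (t : ℝ) : ℝ :=
  trigamma t - 1 / t - 1 / (2 * t ^ 2) - 1 / (6 * t ^ 3) + 1 / (30 * t ^ 5)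

/-- A function is completely monotonic on `(0, ∞)` if it is infinitely differentiable there
and `(−1)ⁿ f⁽ⁿ⁾(t) ≥ 0` for all `n ≥ 0` and `t > 0`. -/
def CompletelyMonotonicOn (f : ℝ → ℝ) : Prop :=
  ContDiffOn ℝ (⊤ : ℕ∞) f (Ioi 0) ∧
    ∀ n : ℕ, ∀ t : ℝ, 0 < t → 0 ≤ (-1 : ℝ) ^ n * iteratedDeriv n f t

/-- `h(s) = s/(1 − e^{−s}) − 1 − s/2 − s²/12 + s⁴/720`. -/
noncomputable def hfun (s : ℝ) : ℝ :=
  s / (1 - Real.exp (-s)) - 1 - s / 2 - s ^ 2 / 12 + s ^ 4 / 720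

open MeasureTheory Polynomial

lemma integral_pow_mul_exp_neg_mul_Ioi (n : ℕ) {a : ℝ} (ha : 0 < a) :
    ∫ s in Ioi (0 : ℝ), s ^ n * Real.exp (-a * s) = n.factorial / a ^ (n + 1) := by
  have h := Real.integral_rpow_mul_exp_neg_mul_Ioi (a := n + 1) (by positivity) ha
  rw [Real.Gamma_nat_eq_factorial] at h
  simp only [add_sub_cancel_right, Real.rpow_natCast] at h
  have e : ((n : ℝ) + 1) = ((n + 1 : ℕ) : ℝ) := by push_cast; ring
  rw [e, Real.rpow_natCast] at h
  simp only [neg_mul]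
  rw [h, one_div, inv_pow]
  ring

lemma integrableOn_pow_mul_exp_neg_mul_Ioi (n : ℕ) {a : ℝ} (ha : 0 < a) :
    IntegrableOn (fun s : ℝ => s ^ n * Real.exp (-a * s)) (Ioi 0) :=
  .of_integral_ne_zero (by rw [integral_pow_mul_exp_neg_mul_Ioi n ha]; positivity)

/-- The functions `r(s) + p(w) + s q(w)` with `w = 1/(e^s - 1)`; they form a class
closed under differentiation. -/
noncomputable def expRational (r p q : ℝ[X]) (s : ℝ) : ℝ :=
  r.eval s + p.eval (Real.exp s - 1)⁻¹ + s * q.eval (Real.exp s - 1)⁻¹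

lemma hasDerivAt_inv_exp_sub_one {s : ℝ} (hs : 0 < s) :
    HasDerivAt (fun s => (Real.exp s - 1)⁻¹)
      (-((Real.exp s - 1)⁻¹ + (Real.exp s - 1)⁻¹ ^ 2)) s := by
  have h0 : Real.exp s - 1 ≠ 0 := by
    have := Real.one_lt_exp_iff.2 hs
    linarith
  convert! ((Real.hasDerivAt_exp s).sub_const 1).inv h0 using 1
  field_simp
  ring

lemma hasDerivAt_expRational (r p q : ℝ[X]) {s : ℝ} (hs : 0 < s) :
    HasDerivAt (expRational r p q)
      (expRational (derivative r) (q - derivative p * (X + X ^ 2))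
        (-(derivative q * (X + X ^ 2))) s) s := by
  have hw := hasDerivAt_inv_exp_sub_one hs
  have hp := (p.hasDerivAt _).comp s hw
  have hq := (q.hasDerivAt _).comp s hw
  convert! ((r.hasDerivAt s).add hp).add ((hasDerivAt_id s).mul hq) using 1
  simp [expRational]
  ring

lemma tendsto_inv_exp_sub_one_atTop :
    Tendsto (fun s => (Real.exp s - 1)⁻¹) atTop (𝓝 0) :=
  (tendsto_atTop_add_const_right _ (-1) Real.tendsto_exp_atTop).inv_tendsto_atTop

lemma Polynomial.tendsto_eval_mul_exp_neg_mul_atTop (r : ℝ[X]) {b : ℝ} (hb : 0 < b) :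
    Tendsto (fun s => r.eval s * Real.exp (-b * s)) atTop (𝓝 0) := by
  have h := (r.comp (C b⁻¹ * X)).tendsto_div_exp_atTop.comp (tendsto_id.const_mul_atTop hb)
  refine h.congr fun s => ?_
  simp [hb.ne', Real.exp_neg, div_eq_mul_inv]

lemma tendsto_expRational_mul_exp_neg_mul_atTop (r p q : ℝ[X]) {b : ℝ} (hb : 0 < b) :
    Tendsto (fun s => expRational r p q s * Real.exp (-b * s)) atTop (𝓝 0) := by
  have hev (u : ℝ[X]) : Tendsto (fun s => u.eval (Real.exp s - 1)⁻¹) atTop (𝓝 (u.eval 0)) :=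
    (u.continuous.tendsto 0).comp tendsto_inv_exp_sub_one_atTop
  have h := ((r.tendsto_eval_mul_exp_neg_mul_atTop hb).add
    ((hev p).mul ((1 : ℝ[X]).tendsto_eval_mul_exp_neg_mul_atTop hb))).add
    ((hev q).mul ((X : ℝ[X]).tendsto_eval_mul_exp_neg_mul_atTop hb))
  simp only [mul_zero, add_zero] at h
  refine h.congr fun s => ?_
  simp [expRational]
  ring

lemma hfun_eq_expRational {s : ℝ} (hs : 0 < s) :
    hfun s = expRational (C (-1) + C (1 / 2) * X - C (1 / 12) * X ^ 2 + C (1 / 720) * X ^ 4)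
      0 X s := by
  have h0 : Real.exp s - 1 ≠ 0 := by
    have := Real.one_lt_exp_iff.2 hs
    linarith
  have h1 : 1 - Real.exp (-s) = (Real.exp s - 1) / Real.exp s := by
    rw [Real.exp_neg]
    field_simp
  rw [hfun, h1]
  simp [expRational]
  field_simp
  ring

lemma exists_iteratedDeriv_hfun_eq (n : ℕ) :
    ∃ r p q : ℝ[X], ∀ s : ℝ, 0 < s → iteratedDeriv n hfun s = expRational r p q s := by
  induction n with
  | zero => exact ⟨_, _, _, fun s hs => by rw [iteratedDeriv_zero, hfun_eq_expRational hs]⟩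
  | succ n ih =>
    obtain ⟨r, p, q, h⟩ := ih
    refine ⟨derivative r, q - derivative p * (X + X ^ 2), -(derivative q * (X + X ^ 2)),
      fun s hs => ?_⟩
    rw [iteratedDeriv_succ, EventuallyEq.deriv_eq (f := expRational r p q)
      (by filter_upwards [eventually_gt_nhds hs] using h)]
    exact (hasDerivAt_expRational r p q hs).deriv

lemma hasDerivAt_iteratedDeriv_hfun (n : ℕ) {s : ℝ} (hs : 0 < s) :
    HasDerivAt (iteratedDeriv n hfun) (iteratedDeriv (n + 1) hfun s) s := by
  obtain ⟨r, p, q, h⟩ := exists_iteratedDeriv_hfun_eq n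
  have hd := (hasDerivAt_expRational r p q hs).congr_of_eventuallyEq
    (f₁ := iteratedDeriv n hfun) (by filter_upwards [eventually_gt_nhds hs] using h)
  rw [iteratedDeriv_succ]
  exact hd.differentiableAt.hasDerivAt

lemma tendsto_iteratedDeriv_hfun_mul_exp_neg_mul_atTop (n : ℕ) {b : ℝ} (hb : 0 < b) :
    Tendsto (fun s => iteratedDeriv n hfun s * Real.exp (-b * s)) atTop (𝓝 0) := by
  obtain ⟨r, p, q, h⟩ := exists_iteratedDeriv_hfun_eq n
  refine (tendsto_expRational_mul_exp_neg_mul_atTop r p q hb).congr' ?_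
  filter_upwards [eventually_gt_atTop 0] with s hs
  rw [h s hs]

lemma exists_hfun_eventuallyEq_pow_mul :
    ∃ K : ℝ → ℝ, AnalyticAt ℝ K 0 ∧ hfun =ᶠ[𝓝[>] 0] fun s => s ^ 4 * K s := by
  obtain ⟨F, hF, hexp⟩ : ∃ F : ℝ → ℝ, AnalyticAt ℝ F 0 ∧ ∀ s, Real.exp (-s) =
      1 - s + s ^ 2 / 2 - s ^ 3 / 6 + s ^ 4 / 24 - s ^ 5 * F s := by
    obtain ⟨G, hG, hexp⟩ := (analyticAt_rexp (x := (0 : ℝ))).exists_eq_sum_add_pow_mul 5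
    refine ⟨fun s => G (-s), AnalyticAt.fun_comp (g := G) (by simpa using hG) (by fun_prop),
      fun s => ?_⟩
    rw [hexp (-s)]
    simp [Finset.sum_range_succ, iteratedDeriv_eq_iterate, Nat.factorial]
    ring
  set g : ℝ → ℝ := fun s => 1 - s / 2 + s ^ 2 / 6 - s ^ 3 / 24 + s ^ 4 * F s with hg
  have hga : AnalyticAt ℝ g 0 := by
    simp only [hg]
    fun_prop
  have hg0 : g 0 ≠ 0 := by simp [hg]
  refine ⟨fun s => (1 / 120 + s / 360 + s ^ 2 / 4320 - s ^ 3 / 17280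
    - F s * (1 + s / 2 + s ^ 2 / 12 - s ^ 4 / 720)) / g s,
    AnalyticAt.fun_div (by fun_prop) hga hg0, ?_⟩
  filter_upwards [nhdsWithin_le_nhds (hga.continuousAt.eventually_ne hg0), self_mem_nhdsWithin]
    with s hgs hs
  have hs0 : s ≠ 0 := (mem_Ioi.1 hs).ne'
  have key : 1 - Real.exp (-s) = s * g s := by
    rw [hexp s, hg]
    ring
  rw [hfun, key, div_mul_cancel_left₀ hs0]
  field_simp
  simp only [hg]
  ring

lemma exists_iteratedDeriv_hfun_eventuallyEq_pow_mul {n m : ℕ} (h : n + m = 4) :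
    ∃ K : ℝ → ℝ, AnalyticAt ℝ K 0 ∧ iteratedDeriv n hfun =ᶠ[𝓝[>] 0] fun s => s ^ m * K s := by
  induction n generalizing m with
  | zero =>
    obtain rfl : m = 4 := by omega
    simpa using exists_hfun_eventuallyEq_pow_mul
  | succ n ih =>
    obtain ⟨K, hK, hev⟩ := ih (m := m + 1) (by omega)
    refine ⟨fun s => (m + 1) * K s + s * deriv K s, ?_, ?_⟩
    · have := hK.deriv
      fun_prop
    filter_upwards [eventually_eventually_nhdsWithin.2 hev,
      nhdsWithin_le_nhds hK.eventually_analyticAt, self_mem_nhdsWithin] with s h1 h2 hs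
    rw [IsOpen.nhdsWithin_eq isOpen_Ioi hs] at h1
    rw [iteratedDeriv_succ, EventuallyEq.deriv_eq h1]
    have hd := ((hasDerivAt_pow (m + 1) s).mul h2.differentiableAt.hasDerivAt).deriv
    refine hd.trans ?_
    push_cast [Nat.add_sub_cancel]
    ring

lemma tendsto_iteratedDeriv_hfun_nhdsGT {n : ℕ} (hn : n < 4) :
    Tendsto (iteratedDeriv n hfun) (𝓝[>] 0) (𝓝 0) := by
  obtain ⟨K, hK, hev⟩ := exists_iteratedDeriv_hfun_eventuallyEq_pow_mul (n := n) (m := 4 - n)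
    (by omega)
  have hc : ContinuousAt (fun s => s ^ (4 - n) * K s) 0 := by
    have := hK.continuousAt
    fun_prop
  have ht := hc.tendsto.mono_left (nhdsWithin_le_nhds (s := Ioi 0))
  rw [zero_pow (by omega), zero_mul] at ht
  exact ht.congr' hev.symm

lemma integrableOn_iteratedDeriv_hfun_mul_exp {n : ℕ} (hn : n ≤ 4) {t : ℝ} (ht : 0 < t) :
    IntegrableOn (fun s => iteratedDeriv n hfun s * Real.exp (-t * s)) (Ioi 0) := by
  have hcont : ContinuousOn (fun s => iteratedDeriv n hfun s * Real.exp (-t * s)) (Ioi 0) :=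
    ContinuousOn.mul (fun s hs =>
      (hasDerivAt_iteratedDeriv_hfun n hs).continuousAt.continuousWithinAt) (by fun_prop)
  rw [integrableOn_Ioi_iff_integrableAtFilter_atTop_nhdsWithin]
  refine ⟨?_, ?_, hcont.locallyIntegrableOn measurableSet_Ioi⟩
  · refine ⟨Ioi 1, Ioi_mem_atTop 1, ?_⟩
    refine integrable_of_isBigO_exp_neg (b := t / 2) (by positivity)
      (hcont.mono (Ici_subset_Ioi.2 one_pos)) ?_
    have h := ((tendsto_iteratedDeriv_hfun_mul_exp_neg_mul_atTop n (half_pos ht)).isBigO_one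
      ℝ).mul (Asymptotics.isBigO_refl (fun s => Real.exp (-(t / 2) * s)) atTop)
    simp only [one_mul] at h
    refine h.congr_left fun s => ?_
    rw [mul_assoc, ← Real.exp_add]
    ring_nf
  · obtain ⟨K, hK, hev⟩ := exists_iteratedDeriv_hfun_eventuallyEq_pow_mul (n := n) (m := 4 - n)
      (by omega)
    have hc : ContinuousAt (fun s => s ^ (4 - n) * K s * Real.exp (-t * s)) 0 := by
      have := hK.continuousAt
      fun_prop
    have hlim := hc.tendsto.mono_left (nhdsWithin_le_nhds (s := Ioi 0))
    refine Measure.FiniteAtFilter.integrableAtFilter_of_tendsto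
      (hcont.stronglyMeasurableAtFilter_nhdsWithin measurableSet_Ioi 0)
      (Measure.finiteAt_nhdsWithin _ _ _) (hlim.congr' ?_)
    filter_upwards [hev] with s hs
    rw [hs]

lemma integral_iteratedDeriv_succ_hfun {n : ℕ} (hn : n < 4) {t : ℝ} (ht : 0 < t) :
    ∫ s in Ioi (0 : ℝ), iteratedDeriv (n + 1) hfun s * Real.exp (-t * s) =
      t * ∫ s in Ioi (0 : ℝ), iteratedDeriv n hfun s * Real.exp (-t * s) := by
  have hexp (s : ℝ) : HasDerivAt (fun s => Real.exp (-t * s)) (-t * Real.exp (-t * s)) s := by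
    convert! ((hasDerivAt_id s).const_mul (-t)).exp using 1
    simp [mul_comm]
  have hint := integrableOn_iteratedDeriv_hfun_mul_exp hn.le ht
  have hzero : Tendsto (iteratedDeriv n hfun * fun s => Real.exp (-t * s)) (𝓝[>] 0) (𝓝 0) := by
    have he : Tendsto (fun s => Real.exp (-t * s)) (𝓝[>] 0) (𝓝 (Real.exp (-t * 0))) :=
      (hexp 0).continuousAt.tendsto.mono_left nhdsWithin_le_nhds
    simpa using! (tendsto_iteratedDeriv_hfun_nhdsGT hn).mul he
  have h := integral_Ioi_mul_deriv_eq_deriv_mul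
    (fun s hs => hasDerivAt_iteratedDeriv_hfun n hs) (fun s _ => hexp s)
    ((hint.const_mul (-t)).congr (ae_of_all _ fun s => by simp; ring))
    (integrableOn_iteratedDeriv_hfun_mul_exp hn ht) hzero
    (tendsto_iteratedDeriv_hfun_mul_exp_neg_mul_atTop n ht)
  simp only [mul_left_comm _ (-t), integral_const_mul] at h
  linarith

lemma hasSum_trigamma_integrand {t s : ℝ} (hs : 0 < s) :
    HasSum (fun n : ℕ => s ^ 1 * Real.exp (-(t + n) * s))
      (s / (1 - Real.exp (-s)) * Real.exp (-t * s)) := by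
  have h := (hasSum_geometric_of_lt_one (Real.exp_pos (-s)).le
    (Real.exp_lt_one_iff.2 (neg_neg_of_pos hs))).mul_left (s * Real.exp (-t * s))
  convert! h using 1
  · ext n
    rw [← Real.exp_nat_mul, mul_assoc, ← Real.exp_add]
    ring_nf
  · ring

lemma trigamma_eq_integral {t : ℝ} (ht : 0 < t) :
    trigamma t = ∫ s in Ioi (0 : ℝ), s / (1 - Real.exp (-s)) * Real.exp (-t * s) := by
  have hpos (n : ℕ) : 0 < t + n := by positivity
  have hval (n : ℕ) : ∫ s in Ioi (0 : ℝ), s ^ 1 * Real.exp (-(t + n) * s) = 1 / (t + n) ^ 2 := by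
    simpa using integral_pow_mul_exp_neg_mul_Ioi 1 (hpos n)
  have hsum : Summable fun n : ℕ => 1 / (t + n) ^ 2 := by
    have h := (Real.summable_one_div_nat_add_rpow t 2).2 one_lt_two
    refine h.congr fun n => ?_
    rw [Real.rpow_two, sq_abs, add_comm]
  have h := hasSum_integral_of_summable_integral_norm
    (fun n : ℕ => integrableOn_pow_mul_exp_neg_mul_Ioi 1 (hpos n)) (hsum.congr fun n => by
      rw [← hval n]
      refine setIntegral_congr_fun measurableSet_Ioi fun s hs => ?_
      have : 0 < s := hs
      exact (Real.norm_of_nonneg (by positivity)).symm)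
  simp only [hval] at h
  rw [trigamma, h.tsum_eq]
  exact setIntegral_congr_fun measurableSet_Ioi fun s hs => (hasSum_trigamma_integrand hs).tsum_eq

lemma integral_hfun_mul_exp {t : ℝ} (ht : 0 < t) :
    ∫ s in Ioi (0 : ℝ), hfun s * Real.exp (-t * s) = Q t := by
  have hh : IntegrableOn (fun s => hfun s * Real.exp (-t * s)) (Ioi 0) := by
    simpa using integrableOn_iteratedDeriv_hfun_mul_exp (n := 0) (by norm_num) ht
  have hi (n : ℕ) (c : ℝ) :
      IntegrableOn (fun s : ℝ => c * (s ^ n * Real.exp (-t * s))) (Ioi 0) :=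
    (integrableOn_pow_mul_exp_neg_mul_Ioi n ht).const_mul c
  have hsplit : trigamma t = ∫ s in Ioi (0 : ℝ), ((((hfun s * Real.exp (-t * s)
      + 1 * (s ^ 0 * Real.exp (-t * s))) + 1 / 2 * (s ^ 1 * Real.exp (-t * s)))
      + 1 / 12 * (s ^ 2 * Real.exp (-t * s))) + (-1 / 720) * (s ^ 4 * Real.exp (-t * s))) := by
    rw [trigamma_eq_integral ht]
    congr 1
    ext s
    rw [hfun]
    ring
  have h0 := Integrable.fun_add hh (hi 0 1)
  have h1 := Integrable.fun_add h0 (hi 1 (1 / 2))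
  have h2 := Integrable.fun_add h1 (hi 2 (1 / 12))
  rw [integral_add h2 (hi 4 _), integral_add h1 (hi 2 _), integral_add h0 (hi 1 _),
    integral_add hh (hi 0 _)] at hsplit
  simp only [integral_const_mul, integral_pow_mul_exp_neg_mul_Ioi _ ht] at hsplit
  rw [Q, hsplit]
  simp [Nat.factorial]
  field_simp
  ring

/-- For every `t > 0`, `t⁴ · Q(t) = ∫₀^∞ h⁽⁴⁾(s) e^{−ts} ds`. -/
theorem t4Q_eq_integral (t : ℝ) (ht : 0 < t) :
    t ^ 4 * Q t = ∫ s in Ioi (0 : ℝ), iteratedDeriv 4 hfun s * Real.exp (-t * s) := by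
  rw [integral_iteratedDeriv_succ_hfun (by norm_num) ht,
    integral_iteratedDeriv_succ_hfun (by norm_num) ht,
    integral_iteratedDeriv_succ_hfun (by norm_num) ht,
    integral_iteratedDeriv_succ_hfun (by norm_num) ht, iteratedDeriv_zero,
    integral_hfun_mul_exp ht]
  ring
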